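/- There do not exist real numbers $\alpha, \beta$ with $0 < \alpha < \pi/3$, $0 < \beta < \pi/2$, such that $\alpha/\pi$ and $\beta/\pi$ are both rational and $2\cos\alpha - \cos\beta = 1$. -/

import Mathlib

open Real

open IntermediateField in
/-- If the cosine of a rational multiple of `π` is a nonzero algebraic integer, then some positive
power of it is `1`. All its conjugates have absolute value at most `1`, so this is Kronecker's
theorem. -/
theorem exists_cos_rat_mul_pi_pow_eq_one {q : ℚ} (h0 : Real.cos (q * π) ≠ 0)
    (hint : IsIntegral ℤ (Real.cos (q * π))) :
    ∃ n : ℕ, 0 < n ∧ Real.cos (q * π) ^ n = 1 := by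
  set z : ℂ := Complex.exp (q * π * Complex.I) with hz
  have hzint : IsIntegral ℚ z := (Complex.isIntegral_exp_rat_mul_pi_mul_I q).tower_top (A := ℚ)
  have hzpow : z ^ (2 * q.den) = 1 := Complex.exp_rat_mul_pi_mul_I_pow_two_mul_den q
  have : FiniteDimensional ℚ ℚ⟮z⟯ := adjoin.finiteDimensional hzint
  have : NumberField ℚ⟮z⟯ := { }
  set w : ℚ⟮z⟯ := AdjoinSimple.gen ℚ z
  have hw : (w : ℂ) = z := AdjoinSimple.coe_gen ℚ z
  have hwpow : w ^ (2 * q.den) = 1 := by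
    apply Subtype.ext
    push_cast
    rw [hw, hzpow]
  have hcos : (((w + w⁻¹) / 2 : ℚ⟮z⟯) : ℂ) = (Real.cos (q * π) : ℝ) := by
    push_cast
    rw [hw, hz, Complex.cos, ← Complex.exp_neg, neg_mul]
    rfl
  have hxint : IsIntegral ℤ ((w + w⁻¹) / 2) := by
    rw [← isIntegral_algebraMap_iff (algebraMap ℚ⟮z⟯ ℂ).injective,
      IntermediateField.algebraMap_apply, hcos]
    exact (isIntegral_algebraMap_iff (A := ℝ) (B := ℂ) Complex.ofReal_injective).mpr hint
  obtain ⟨n, hn, hpow⟩ := NumberField.Embeddings.pow_eq_one_of_norm_le_one ℚ⟮z⟯ ℂ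
    (x := (w + w⁻¹) / 2) (fun h ↦ h0 <| Complex.ofReal_injective <| hcos.symm.trans <| by simp [h])
    hxint fun φ ↦ by
      have hφ : ‖φ w‖ = 1 := Complex.norm_eq_one_of_pow_eq_one (n := 2 * q.den)
        (by rw [← map_pow, hwpow, map_one]) (by simp)
      have := norm_add_le (φ w) (φ w)⁻¹
      rw [norm_inv, hφ] at this
      rw [map_div₀, map_add, map_inv₀, map_ofNat, norm_div, Complex.norm_ofNat]
      linarith
  refine ⟨n, hn, ?_⟩
  have := congrArg (fun x : ℚ⟮z⟯ ↦ (x : ℂ)) hpow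
  simp only [SubmonoidClass.coe_pow, OneMemClass.coe_one] at this
  rw [hcos] at this
  exact_mod_cast this

/-- There are no angles `α ∈ (0, π/3)`, `β ∈ (0, π/2)`, both rational multiples of `π`,
with `2cos α - cos β = 1`. -/
theorem stmt_8 :
    ¬ ∃ α β : ℝ, 0 < α ∧ α < π / 3 ∧ 0 < β ∧ β < π / 2 ∧
      (∃ q : ℚ, α = q * π) ∧ (∃ q : ℚ, β = q * π) ∧
      2 * Real.cos α - Real.cos β = 1 := by
  rintro ⟨_, _, -, -, hβ0, hβ, ⟨p, rfl⟩, ⟨q, rfl⟩, h⟩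
  have hpos : 0 < Real.cos (q * π) := Real.cos_pos_of_mem_Ioo ⟨by linarith, hβ⟩
  have hlt : Real.cos (q * π) < 1 := by
    simpa using Real.cos_lt_cos_of_nonneg_of_le_pi_div_two le_rfl hβ.le hβ0
  have hint : IsIntegral ℤ (Real.cos (q * π)) := by
    rw [show Real.cos (q * π) = 2 * Real.cos (p * π) - 1 by linarith]
    exact (Real.isIntegral_two_mul_cos_rat_mul_pi p).sub isIntegral_one
  obtain ⟨n, hn, hpow⟩ := exists_cos_rat_mul_pi_pow_eq_one hpos.ne' hint
  exact (pow_lt_one₀ hpos.le hlt hn.ne').ne hpow
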